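/- arXiv:math/0108120 — 3 statements merged into one kernel-verified Lean document; each statement's English description precedes it below -/
import Mathlib

section
/- Let d ≥ 1 and β > 0. There exists a constant b_* = b_*(β) > 0 such that for every sequence of positive reals q_n with q_n → 0 as n → ∞ and every 0 < b < b_*, one has E₀(e^{−β J_n} · 1{J_n ≤ n·q_n}) = o(E₀(e^{−β J_n} · 1{J_n < b n})) as n → ∞. -/
open Filter

/-- A single step in `ℤ^d`: a coordinate direction together with a sign,
so that there are exactly `2d` possible steps. -/
def stepVec (d : ℕ) (s : Fin d × Bool) (k : Fin d) : ℤ :=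
  if k = s.1 then (if s.2 then 1 else -1) else 0

/-- An `n`-step nearest-neighbour path in `ℤ^d` starting at the origin,
encoded by its sequence of steps. -/
abbrev Walk (d n : ℕ) := Fin n → Fin d × Bool

/-- The position `S(i)` of the walk after `i` steps. -/
def walkPos {d n : ℕ} (w : Walk d n) (i : ℕ) : Fin d → ℤ :=
  fun k => ∑ j ∈ Finset.filter (fun j : Fin n => (j : ℕ) < i) Finset.univ, stepVec d (w j) k

/-- The self-intersection local time `J_n = #{(i,j) : 0 ≤ i < j ≤ n, S(i) = S(j)}`. -/
def silt {d n : ℕ} (w : Walk d n) : ℕ :=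
  (((Finset.range (n+1)) ×ˢ (Finset.range (n+1))).filter
    (fun p => p.1 < p.2 ∧ walkPos w p.1 = walkPos w p.2)).card

/-- The Euclidean distance `χ_n = ‖S(n)‖₂` of the endpoint from the origin. -/
noncomputable def chi {d n : ℕ} (w : Walk d n) : ℝ :=
  Real.sqrt (∑ k : Fin d, ((walkPos w n k : ℝ))^2)

/-- Expectation `E₀` under the uniform measure on the `(2d)^n` `n`-step paths. -/
noncomputable def E0 (d n : ℕ) (f : Walk d n → ℝ) : ℝ :=
  (∑ w : Walk d n, f w) / ((2*d : ℝ))^n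

/-- Expectation `E_β` with respect to the weakly self-avoiding walk measure
`Q_n^β(A) = E₀(e^{-β J_n} 1_A)/E₀(e^{-β J_n})`. -/
noncomputable def Ewsaw (d n : ℕ) (β : ℝ) (f : Walk d n → ℝ) : ℝ :=
  (∑ w : Walk d n, Real.exp (-β * (silt w : ℝ)) * f w) /
    (∑ w : Walk d n, Real.exp (-β * (silt w : ℝ)))

/-- The exponent `μ(d)`: `μ(1) = 1` and `μ(d) = max(1/2, 1/4 + 1/d)` for `d ≥ 2`. -/
noncomputable def mu (d : ℕ) : ℝ :=
  if d = 1 then 1 else max (1/2) (1/4 + 1/(d : ℝ))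

/-- The same step with its sign reversed. -/
def flipStep {d : ℕ} (s : Fin d × Bool) : Fin d × Bool := (s.1, !s.2)

lemma stepVec_flipStep {d : ℕ} (s : Fin d × Bool) :
    stepVec d (flipStep s) = -stepVec d s := by
  funext k
  rcases s with ⟨l, b⟩
  cases b <;> by_cases h : k = l <;> simp [stepVec, flipStep, h]

lemma walkPos_succ {d n : ℕ} (w : Walk d n) (i : ℕ) (hi : i < n) :
    walkPos w (i + 1) = walkPos w i + stepVec d (w ⟨i, hi⟩) := by
  funext k
  have h : Finset.filter (fun j : Fin n => (j : ℕ) < i + 1) Finset.univ =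
      insert ⟨i, hi⟩ (Finset.filter (fun j : Fin n => (j : ℕ) < i) Finset.univ) := by
    ext j
    simp only [Finset.mem_filter, Finset.mem_univ, true_and, Finset.mem_insert, Fin.ext_iff]
    omega
  simp only [walkPos, h, Pi.add_apply]
  rw [Finset.sum_insert (by simp), add_comm]

/-- The walk obtained from `w` by retracing step `i` backwards and forwards once more,
and dropping the last two steps of `w`. -/
def spike {d n : ℕ} (w : Walk d n) (i : ℕ) : Walk d n := fun j =>
  if (j : ℕ) ≤ i then w j
  else if (j : ℕ) = i + 1 then flipStep (w ⟨j - 1, by omega⟩)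
  else w ⟨j - 2, by omega⟩

/-- The time of `w` whose position `spike w i` occupies at time `j`. -/
def spikeTime (i j : ℕ) : ℕ := if j ≤ i + 1 then j else j - 2

lemma walkPos_spike {d n : ℕ} (w : Walk d n) (i j : ℕ) (hj : j ≤ n) :
    walkPos (spike w i) j = walkPos w (spikeTime i j) := by
  induction j with
  | zero => funext k; simp [spikeTime, walkPos]
  | succ j ih =>
    have hjn : j < n := hj
    rw [walkPos_succ _ j hjn, ih hjn.le]
    rcases lt_trichotomy j (i + 1) with h | h | h
    · have e1 : spikeTime i j = j := by simp only [spikeTime]; split_ifs <;> omega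
      have e2 : spikeTime i (j + 1) = j + 1 := by simp only [spikeTime]; split_ifs <;> omega
      have e3 : spike w i ⟨j, hjn⟩ = w ⟨j, hjn⟩ := by
        simp only [spike]; rw [if_pos (by omega)]
      rw [e1, e2, e3, walkPos_succ _ j hjn]
    · subst h
      have e1 : spikeTime i (i + 1) = i + 1 := by simp [spikeTime]
      have e2 : spikeTime i (i + 1 + 1) = i := by simp [spikeTime]
      have e3 : spike w i ⟨i + 1, hjn⟩ = flipStep (w ⟨i, by omega⟩) := by
        simp [spike]
      rw [e1, e2, e3, walkPos_succ _ i (by omega), stepVec_flipStep]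
      abel
    · obtain ⟨l, rfl⟩ : ∃ l, j = l + 2 := ⟨j - 2, by omega⟩
      have e1 : spikeTime i (l + 2) = l := by simp only [spikeTime]; split_ifs <;> omega
      have e2 : spikeTime i (l + 2 + 1) = l + 1 := by simp only [spikeTime]; split_ifs <;> omega
      have e3 : spike w i ⟨l + 2, hjn⟩ = w ⟨l, by omega⟩ := by
        simp only [spike]; rw [if_neg (by omega), if_neg (by omega)]
        congr 1
      rw [e1, e2, e3, walkPos_succ _ l (by omega)]

/-- The site occupied at time `i` is occupied at no other time. -/
def IsSimpleTime {d n : ℕ} (w : Walk d n) (i : ℕ) : Prop :=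
  ∀ j ≤ n, walkPos w j = walkPos w i → j = i

lemma silt_spike_le {d n : ℕ} (w : Walk d n) (i : ℕ) (hi : i + 2 < n)
    (h₀ : IsSimpleTime w i) (h₁ : IsSimpleTime w (i + 1)) :
    silt (spike w i) ≤ silt w + 2 := by
  unfold silt
  set P := ((Finset.range (n + 1)) ×ˢ (Finset.range (n + 1))).filter
    (fun p => p.1 < p.2 ∧ walkPos (spike w i) p.1 = walkPos (spike w i) p.2) with hP
  set T : Finset (ℕ × ℕ) := {(i, i + 2), (i + 1, i + 3)} with hT
  have key : ∀ p ∈ P \ T, p.1 < p.2 ∧ p.2 ≤ n ∧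
      walkPos w (spikeTime i p.1) = walkPos w (spikeTime i p.2) ∧
      (p.1 < i ∨ i + 3 < p.1) ∧ (p.2 < i ∨ i + 3 < p.2) := by
    rintro ⟨a, b⟩ hp
    simp only [hP, hT, Finset.mem_sdiff, Finset.mem_filter, Finset.mem_product,
      Finset.mem_range, Finset.mem_insert, Finset.mem_singleton, Prod.mk.injEq] at hp
    obtain ⟨⟨⟨ha, hb⟩, hab, heq⟩, hne⟩ := hp
    rw [walkPos_spike _ _ _ (by omega), walkPos_spike _ _ _ (by omega)] at heq
    have hsa : spikeTime i a ≤ n := by simp only [spikeTime]; split_ifs <;> omega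
    have hsb : spikeTime i b ≤ n := by simp only [spikeTime]; split_ifs <;> omega
    have c1 : spikeTime i a = i → spikeTime i b = i := fun h => by
      rw [h] at heq; exact h₀ _ hsb heq.symm
    have c2 : spikeTime i a = i + 1 → spikeTime i b = i + 1 := fun h => by
      rw [h] at heq; exact h₁ _ hsb heq.symm
    have c3 : spikeTime i b = i → spikeTime i a = i := fun h => by
      rw [h] at heq; exact h₀ _ hsa heq
    have c4 : spikeTime i b = i + 1 → spikeTime i a = i + 1 := fun h => by
      rw [h] at heq; exact h₁ _ hsa heq
    refine ⟨hab, by simp only; omega, heq, ?_⟩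
    simp only [spikeTime] at c1 c2 c3 c4 ⊢
    split_ifs at c1 c2 c3 c4 <;> omega
  have h1 : (P \ T).card ≤ (((Finset.range (n + 1)) ×ˢ (Finset.range (n + 1))).filter
      (fun p => p.1 < p.2 ∧ walkPos w p.1 = walkPos w p.2)).card := by
    apply Finset.card_le_card_of_injOn (fun p => (spikeTime i p.1, spikeTime i p.2))
    · intro p hp
      obtain ⟨k1, k2, k3, k4, k5⟩ := key p hp
      simp only [Finset.coe_filter, Finset.mem_product, Finset.mem_range, Set.mem_ofPred_eq]
      refine ⟨?_, ?_, k3⟩ <;> simp only [spikeTime] <;> split_ifs <;> omega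
    · intro p hp p' hp' he
      obtain ⟨k1, k2, k3, k4, k5⟩ := key p hp
      obtain ⟨l1, l2, l3, l4, l5⟩ := key p' hp'
      simp only [spikeTime, Prod.mk.injEq] at he
      ext <;> split_ifs at he <;> omega
  have h2 : T.card ≤ 2 := Finset.card_le_two
  have h3 : P.card ≤ (P \ T).card + T.card := by
    have := Finset.le_card_sdiff T P
    omega
  omega

open Classical in
/-- The spike positions creating exactly two new self-intersections. -/
noncomputable def goodTimes {d m : ℕ} (w : Walk d (m + 2)) : Finset ℕ :=
  (Finset.range m).filter (fun i => IsSimpleTime w i ∧ IsSimpleTime w (i + 1))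

lemma le_card_goodTimes {d m : ℕ} (w : Walk d (m + 2)) :
    m ≤ (goodTimes w).card + 4 * silt w := by
  classical
  set Q := ((Finset.range (m + 2 + 1)) ×ˢ (Finset.range (m + 2 + 1))).filter
    (fun p => p.1 < p.2 ∧ walkPos w p.1 = walkPos w p.2) with hQ
  set N := Q.image Prod.fst ∪ Q.image Prod.snd with hN
  have hNc : N.card ≤ 2 * silt w := by
    have h1 : (Q.image Prod.fst).card ≤ Q.card := Finset.card_image_le
    have h2 : (Q.image Prod.snd).card ≤ Q.card := Finset.card_image_le
    have h3 := Finset.card_union_le (Q.image Prod.fst) (Q.image Prod.snd)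
    have h4 : silt w = Q.card := rfl
    rw [hN]
    omega
  have hmem : ∀ i ≤ m + 2, ¬ IsSimpleTime w i → i ∈ N := by
    intro i hi h
    simp only [IsSimpleTime, not_forall] at h
    obtain ⟨j, hj, he, hne⟩ := h
    simp only [hN, hQ, Finset.mem_union, Finset.mem_image, Finset.mem_filter,
      Finset.mem_product, Finset.mem_range]
    rcases lt_or_gt_of_ne hne with hl | hl
    · exact Or.inr ⟨(j, i), ⟨⟨by simp only; omega, by simp only; omega⟩, hl, he⟩, rfl⟩
    · exact Or.inl ⟨(i, j), ⟨⟨by simp only; omega, by simp only; omega⟩, hl, he.symm⟩, rfl⟩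
  have hsub : Finset.range m ⊆ goodTimes w ∪ (N ∪ N.image (fun x => x - 1)) := by
    intro i hi
    have hi' := Finset.mem_range.1 hi
    by_cases h0 : IsSimpleTime w i
    · by_cases h1 : IsSimpleTime w (i + 1)
      · exact Finset.mem_union_left _ (Finset.mem_filter.2 ⟨hi, h0, h1⟩)
      · exact Finset.mem_union_right _ (Finset.mem_union_right _
          (Finset.mem_image.2 ⟨i + 1, hmem _ (by omega) h1, by simp⟩))
    · exact Finset.mem_union_right _ (Finset.mem_union_left _ (hmem _ (by omega) h0))
  have c0 := Finset.card_le_card hsub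
  rw [Finset.card_range] at c0
  have c1 := Finset.card_union_le (goodTimes w) (N ∪ N.image (fun x => x - 1))
  have c2 := Finset.card_union_le N (N.image (fun x => x - 1))
  have c3 : (N.image (fun x => x - 1)).card ≤ N.card := Finset.card_image_le
  omega

/-- The times at which a walk is about to perform an immediate reversal. -/
def reversalTimes {d m : ℕ} (w : Walk d (m + 2)) : Finset ℕ :=
  (Finset.range m).filter (fun i => walkPos w i = walkPos w (i + 2))

lemma card_reversalTimes_le {d m : ℕ} (w : Walk d (m + 2)) :
    (reversalTimes w).card ≤ silt w := by
  apply Finset.card_le_card_of_injOn (fun i => (i, i + 2))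
  · intro i hi
    simp only [reversalTimes, Finset.coe_filter, Finset.mem_range, Set.mem_ofPred_eq] at hi
    simp only [Finset.coe_filter, Finset.mem_product, Finset.mem_range, Set.mem_ofPred_eq]
    exact ⟨by omega, by omega, hi.2⟩
  · intro i _ j _ h
    exact (Prod.mk.inj h).1

lemma mem_reversalTimes_spike {d m : ℕ} (w : Walk d (m + 2)) {i : ℕ} (hi : i < m) :
    i ∈ reversalTimes (spike w i) := by
  rw [reversalTimes, Finset.mem_filter, Finset.mem_range]
  refine ⟨hi, ?_⟩
  rw [walkPos_spike _ _ _ (by omega), walkPos_spike _ _ _ (by omega)]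
  simp [spikeTime]

/-- A walk is determined by its spiked version together with the two dropped steps. -/
lemma eq_of_spike_eq {d m : ℕ} {w w' : Walk d (m + 2)} {i : ℕ}
    (h : spike w i = spike w' i) (h0 : w ⟨m, by omega⟩ = w' ⟨m, by omega⟩)
    (h1 : w ⟨m + 1, by omega⟩ = w' ⟨m + 1, by omega⟩) : w = w' := by
  funext ⟨j, hj⟩
  rcases Nat.lt_or_ge j m with hjm | hjm
  · rcases Nat.lt_or_ge i j with hij | hij
    · have e := congrFun h ⟨j + 2, by omega⟩
      simp only [spike] at e
      rw [if_neg (by omega), if_neg (by omega), if_neg (by omega), if_neg (by omega)] at e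
      exact e
    · have e := congrFun h ⟨j, hj⟩
      simp only [spike] at e
      rwa [if_pos hij, if_pos hij] at e
  · obtain rfl | rfl : j = m ∨ j = m + 1 := by omega
    · exact h0
    · exact h1

/-- The total weight of the walks with at most `a` self-intersections. -/
noncomputable def weightLE (d n : ℕ) (β a : ℝ) : ℝ :=
  ∑ w : Walk d n, Real.exp (-β * (silt w : ℝ)) * (if (silt w : ℝ) ≤ a then 1 else 0)

lemma weightLE_spike_bound (d m : ℕ) (β : ℝ) (hβ : 0 < β) (a : ℝ) :
    ((m : ℝ) - 4 * a) * weightLE d (m + 2) β a ≤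
      Real.exp (2 * β) * (2 * d) ^ 2 * (a + 2) * weightLE d (m + 2) β (a + 2) := by
  classical
  set A : Finset (Σ _ : Walk d (m + 2), ℕ) :=
    (Finset.univ.filter (fun w : Walk d (m + 2) => (silt w : ℝ) ≤ a)).sigma goodTimes with hA
  set B : Finset (Σ _ : Walk d (m + 2), ℕ × (Fin d × Bool) × (Fin d × Bool)) :=
    (Finset.univ.filter (fun w : Walk d (m + 2) => (silt w : ℝ) ≤ a + 2)).sigma
      (fun w => reversalTimes w ×ˢ Finset.univ) with hB
  set F : (Σ _ : Walk d (m + 2), ℕ) →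
      (Σ _ : Walk d (m + 2), ℕ × (Fin d × Bool) × (Fin d × Bool)) :=
    fun x => ⟨spike x.1 x.2, x.2, x.1 ⟨m, by omega⟩, x.1 ⟨m + 1, by omega⟩⟩ with hF
  have memA : ∀ x ∈ A, (silt x.1 : ℝ) ≤ a ∧ x.2 < m ∧
      (silt (spike x.1 x.2) : ℝ) ≤ silt x.1 + 2 := by
    intro x hx
    simp only [hA, Finset.mem_sigma, Finset.mem_filter, Finset.mem_univ, true_and, goodTimes,
      Finset.mem_range] at hx
    refine ⟨hx.1, hx.2.1, ?_⟩
    exact_mod_cast silt_spike_le x.1 x.2 (by omega) hx.2.2.1 hx.2.2.2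
  have hmaps : ∀ x ∈ A, F x ∈ B := by
    intro x hx
    obtain ⟨h1, h2, h3⟩ := memA x hx
    simp only [hB, hF, Finset.mem_sigma, Finset.mem_filter, Finset.mem_univ, true_and,
      Finset.mem_product, and_true]
    exact ⟨by linarith, mem_reversalTimes_spike _ h2⟩
  have hinj : Set.InjOn F A := by
    rintro ⟨w, i⟩ _ ⟨w', i'⟩ _ h
    simp only [hF, Sigma.mk.injEq, heq_eq_eq, Prod.mk.injEq] at h
    obtain ⟨h1, rfl, h2, h3⟩ := h
    rw [eq_of_spike_eq h1 h2 h3]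
  have hsum : ∀ c : ℝ, weightLE d (m + 2) β c =
      ∑ w ∈ Finset.univ.filter (fun w : Walk d (m + 2) => (silt w : ℝ) ≤ c),
        Real.exp (-β * (silt w : ℝ)) := by
    intro c
    simp [weightLE, Finset.sum_filter]
  calc ((m : ℝ) - 4 * a) * weightLE d (m + 2) β a
      ≤ ∑ x ∈ A, Real.exp (-β * (silt x.1 : ℝ)) := by
        rw [hA, Finset.sum_sigma, hsum, Finset.mul_sum]
        apply Finset.sum_le_sum
        intro w hw
        simp only [Finset.sum_const, nsmul_eq_mul]
        apply mul_le_mul_of_nonneg_right _ (Real.exp_pos _).le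
        have h1 : (silt w : ℝ) ≤ a := (Finset.mem_filter.1 hw).2
        have h2 : (m : ℝ) ≤ (goodTimes w).card + 4 * silt w := by
          exact_mod_cast le_card_goodTimes w
        linarith
    _ ≤ ∑ x ∈ A, Real.exp (2 * β) * Real.exp (-β * (silt (F x).1 : ℝ)) := by
        apply Finset.sum_le_sum
        intro x hx
        rw [← Real.exp_add]
        apply Real.exp_le_exp.2
        have := (memA x hx).2.2
        simp only [hF]
        nlinarith
    _ = ∑ y ∈ A.image F, Real.exp (2 * β) * Real.exp (-β * (silt y.1 : ℝ)) := by
        rw [Finset.sum_image hinj]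
    _ ≤ ∑ y ∈ B, Real.exp (2 * β) * Real.exp (-β * (silt y.1 : ℝ)) := by
        apply Finset.sum_le_sum_of_subset_of_nonneg
        · exact Finset.image_subset_iff.2 hmaps
        · intros; positivity
    _ ≤ _ := by
        rw [hB, Finset.sum_sigma, hsum, Finset.mul_sum]
        apply Finset.sum_le_sum
        intro w hw
        have h1 : (silt w : ℝ) ≤ a + 2 := (Finset.mem_filter.1 hw).2
        have h2 : ((reversalTimes w).card : ℝ) ≤ silt w := by
          exact_mod_cast card_reversalTimes_le w
        simp only [Finset.sum_const, nsmul_eq_mul, Finset.card_product, Finset.card_univ,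
          Fintype.card_prod, Fintype.card_fin, Fintype.card_bool]
        push_cast
        have h3 : ((reversalTimes w).card : ℝ) * (Real.exp (2 * β) * (2 * d) ^ 2 *
            Real.exp (-β * (silt w : ℝ))) ≤ (a + 2) * (Real.exp (2 * β) * (2 * d) ^ 2 *
            Real.exp (-β * (silt w : ℝ))) :=
          mul_le_mul_of_nonneg_right (h2.trans h1) (by positivity)
        linarith

/-- for any sequence `q_n → 0` of positive reals and `0 < b < b_*`,
`E₀(e^{-βJ_n} 1{J_n ≤ n q_n}) = o(E₀(e^{-βJ_n} 1{J_n < bn}))` as `n → ∞`. -/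
theorem silt_lower_bound_general (d : ℕ) (hd : 1 ≤ d) (β : ℝ) (hβ : 0 < β) :
    ∃ bstar : ℝ, 0 < bstar ∧
      ∀ q : ℕ → ℝ, (∀ n, 0 < q n) →
        Filter.Tendsto q Filter.atTop (nhds 0) →
        ∀ b : ℝ, 0 < b → b < bstar →
          Filter.Tendsto
            (fun n : ℕ =>
              E0 d n (fun w => Real.exp (-β * (silt w : ℝ)) *
                  (if (silt w : ℝ) ≤ (n : ℝ) * q n then 1 else 0)) /
              E0 d n (fun w => Real.exp (-β * (silt w : ℝ)) *
                  (if (silt w : ℝ) < b * n then 1 else 0)))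
            Filter.atTop (nhds 0) := by
  refine ⟨1, one_pos, fun q hq hq0 b hb _ => ?_⟩
  set C : ℝ := Real.exp (2 * β) * (2 * d) ^ 2 with hC
  have hC0 : 0 ≤ C := by positivity
  have hinv : Tendsto (fun n : ℕ => 2 / (n : ℝ)) atTop (nhds 0) :=
    tendsto_const_div_atTop_nhds_zero_nat 2
  have hnum : Tendsto (fun n : ℕ => C * (q n + 2 / n)) atTop (nhds 0) := by
    simpa using (hq0.add hinv).const_mul C
  have hden : Tendsto (fun n : ℕ => 1 - 2 / (n : ℝ) - 4 * q n) atTop (nhds 1) := by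
    simpa using (hinv.const_sub 1).sub (hq0.const_mul 4)
  have hlim : Tendsto (fun n : ℕ => C * (q n + 2 / n) / (1 - 2 / (n : ℝ) - 4 * q n))
      atTop (nhds 0) := by
    have h := hnum.div hden one_ne_zero
    rw [zero_div] at h
    exact h
  have hsmall : ∀ᶠ n : ℕ in atTop, q n + 2 / n < b := by
    have : Tendsto (fun n : ℕ => q n + 2 / n) atTop (nhds 0) := by simpa using hq0.add hinv
    exact this.eventually_lt_const hb
  have hE : ∀ (n : ℕ) (f : Walk d n → ℝ), (∀ w, 0 ≤ f w) → 0 ≤ E0 d n f := fun n f hf =>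
    div_nonneg (Finset.sum_nonneg fun w _ => hf w) (by positivity)
  refine tendsto_of_tendsto_of_tendsto_of_le_of_le' tendsto_const_nhds hlim
    (Eventually.of_forall fun n => ?_) ?_
  · apply div_nonneg <;> apply hE <;> intro w <;> split_ifs <;> positivity
  filter_upwards [hsmall, hden.eventually_const_lt one_pos, eventually_ge_atTop 2]
    with n hn1 hn2 hn3
  obtain ⟨m, rfl⟩ : ∃ m, n = m + 2 := ⟨n - 2, by omega⟩
  have hd0 : ((2 * d : ℝ)) ^ (m + 2) ≠ 0 := by
    have : (0 : ℝ) < d := by exact_mod_cast hd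
    positivity
  unfold E0
  rw [div_div_div_cancel_right₀ hd0]
  set N : ℝ := ((m + 2 : ℕ) : ℝ) with hN
  have hN0 : 0 < N := by rw [hN]; positivity
  have hm : (m : ℝ) = N - 2 := by rw [hN]; push_cast; ring
  have hq1 := hq (m + 2)
  set r := q (m + 2)
  set D := ∑ w : Walk d (m + 2), Real.exp (-β * (silt w : ℝ)) *
    (if (silt w : ℝ) < b * N then 1 else 0) with hD
  have hD0 : 0 ≤ D := Finset.sum_nonneg fun w _ => by split_ifs <;> positivity
  have hle : N * r + 2 < b * N := by
    have := mul_lt_mul_of_pos_left hn1 hN0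
    rw [mul_add, mul_div_cancel₀ _ hN0.ne'] at this
    linarith
  have hWD : weightLE d (m + 2) β (N * r + 2) ≤ D := by
    apply Finset.sum_le_sum
    intro w _
    apply mul_le_mul_of_nonneg_left _ (Real.exp_pos _).le
    split_ifs with h1 h2
    · exact le_rfl
    · exact absurd (h1.trans_lt hle) h2
    · exact zero_le_one
    · exact le_rfl
  have hb1 := weightLE_spike_bound d m β hβ (N * r)
  rw [← hC, hm] at hb1
  have hb2 : C * (N * r + 2) * weightLE d (m + 2) β (N * r + 2) ≤ C * (N * r + 2) * D :=
    mul_le_mul_of_nonneg_left hWD (by positivity)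
  have hb3 := hb1.trans hb2
  change weightLE d (m + 2) β (N * r) / D ≤ _
  refine div_le_of_le_mul₀ hD0 (by positivity) ?_
  rw [div_mul_eq_mul_div, le_div_iff₀ hn2]
  refine le_of_mul_le_mul_left ?_ hN0
  have e1 : N * (weightLE d (m + 2) β (N * r) * (1 - 2 / N - 4 * r)) =
      (N - 2 - 4 * (N * r)) * weightLE d (m + 2) β (N * r) := by
    field_simp
  have e2 : N * (C * (r + 2 / N) * D) = C * (N * r + 2) * D := by
    field_simp
  rw [e1, e2]
  exact hb3
end

section
/- For the simple random walk in Z² (dimension d = 2), the expected self-intersection local time satisfies E₀(J_n) = (1/π + o(1)) · n ln n as n → ∞; that is, lim_{n→∞} E₀(J_n)/(n ln n) = 1/π. -/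
open Filter

/-- Rotating the lattice by 45 degrees turns a planar step into two independent signs. -/
def stepEquiv : Fin 2 × Bool ≃ Bool × Bool where
  toFun s := (s.2, if s.1 = 0 then s.2 else !s.2)
  invFun b := (if b.1 = b.2 then 0 else 1, b.1)
  left_inv := by decide
  right_inv := by decide

/-- The sign encoded by a Boolean. -/
def boolSign (b : Bool) : ℤ := if b then 1 else -1

theorem stepVec_add (s : Fin 2 × Bool) :
    stepVec 2 s 0 + stepVec 2 s 1 = boolSign (stepEquiv s).1 := by
  revert s; decide

theorem stepVec_sub (s : Fin 2 × Bool) :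
    stepVec 2 s 0 - stepVec 2 s 1 = boolSign (stepEquiv s).2 := by
  revert s; decide

theorem sum_boolSign {ι : Type*} (A : Finset ι) (f : ι → Bool) :
    ∑ t ∈ A, boolSign (f t) = 2 * (A.filter (fun t => f t = true)).card - A.card := by
  have h : ∀ t, boolSign (f t) = 2 * (if f t = true then 1 else 0) - 1 := by
    intro t; cases f t <;> simp [boolSign]
  simp_rw [h, Finset.sum_sub_distrib, ← Finset.mul_sum]
  simp

/-- The number of sequences of `k` signs with vanishing sum. -/
def balancedCount (k : ℕ) : ℕ := if Even k then k.choose (k / 2) else 0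

theorem card_boolSign_sum_eq_zero (ι : Type*) [Fintype ι] [DecidableEq ι] :
    (Finset.univ.filter (fun f : ι → Bool => ∑ t, boolSign (f t) = 0)).card =
      balancedCount (Fintype.card ι) := by
  unfold balancedCount
  split_ifs with h
  · rw [← Finset.card_univ, ← Finset.card_powersetCard]
    refine Finset.card_bij' (fun f _ => Finset.univ.filter (fun t => f t = true))
      (fun s _ t => decide (t ∈ s)) ?_ ?_ ?_ ?_
    · intro f hf
      simp only [Finset.mem_filter, Finset.mem_univ, true_and, sum_boolSign] at hf
      simp only [Finset.mem_powersetCard, Finset.subset_univ, true_and]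
      omega
    · intro s hs
      simp only [Finset.mem_powersetCard, Finset.subset_univ, true_and] at hs
      simp only [Finset.mem_filter, Finset.mem_univ, true_and, sum_boolSign, decide_eq_true_eq,
        Finset.filter_univ_mem, hs]
      rw [Finset.card_univ]
      obtain ⟨r, hr⟩ := h
      omega
    · intro f _
      ext t
      simp
    · intro s _
      ext t
      simp
  · rw [Finset.card_eq_zero, Finset.filter_eq_empty_iff]
    intro f _ hf
    rw [sum_boolSign, Finset.card_univ] at hf
    apply h
    rw [Nat.even_iff]
    omega

theorem card_boolSign_sum_finset_eq_zero {ι : Type*} [Fintype ι] [DecidableEq ι] (A : Finset ι) :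
    (Finset.univ.filter (fun f : ι → Bool => ∑ t ∈ A, boolSign (f t) = 0)).card =
      balancedCount A.card * 2 ^ (Fintype.card ι - A.card) := by
  have h1 := card_boolSign_sum_eq_zero {t // t ∈ A}
  rw [Fintype.card_coe] at h1
  have h2 : Fintype.card ({t // t ∉ A} → Bool) = 2 ^ (Fintype.card ι - A.card) := by
    simp [Fintype.card_subtype_compl]
  rw [← h1, ← h2, ← Finset.card_univ, ← Finset.card_product]
  refine Finset.card_equiv (Equiv.piEquivPiSubtypeProd (fun t => t ∈ A) (fun _ => Bool)) ?_
  intro f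
  simp only [Finset.mem_filter, Finset.mem_univ, true_and, Finset.mem_product, and_true,
    Equiv.piEquivPiSubtypeProd_apply]
  rw [← Finset.sum_coe_sort A]

theorem walkPos_eq_iff {n : ℕ} (w : Walk 2 n) {i j : ℕ} (hij : i ≤ j) :
    walkPos w i = walkPos w j ↔
      (∑ t ∈ Finset.univ.filter (fun t : Fin n => i ≤ t ∧ (t : ℕ) < j),
          boolSign (stepEquiv (w t)).1 = 0) ∧
        ∑ t ∈ Finset.univ.filter (fun t : Fin n => i ≤ t ∧ (t : ℕ) < j),
          boolSign (stepEquiv (w t)).2 = 0 := by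
  have key : ∀ k, walkPos w j k = walkPos w i k +
      ∑ t ∈ Finset.univ.filter (fun t : Fin n => i ≤ t ∧ (t : ℕ) < j), stepVec 2 (w t) k := by
    intro k
    unfold walkPos
    rw [← Finset.sum_union]
    · congr 1
      ext t
      simp only [Finset.mem_filter, Finset.mem_univ, true_and, Finset.mem_union]
      omega
    · rw [Finset.disjoint_filter]
      intro t _ h
      omega
  simp_rw [← stepVec_add, ← stepVec_sub, Finset.sum_add_distrib, Finset.sum_sub_distrib]
  rw [funext_iff, Fin.forall_fin_two, key 0, key 1]
  omega

theorem card_fin_filter_Ico {n i j : ℕ} (hj : j ≤ n) :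
    (Finset.univ.filter (fun t : Fin n => i ≤ t ∧ (t : ℕ) < j)).card = j - i := by
  rw [← Nat.card_Ico, ← Finset.card_map Fin.valEmbedding]
  congr 1
  ext t
  simp only [Finset.mem_map, Finset.mem_filter, Finset.mem_univ, true_and, Fin.valEmbedding_apply,
    Finset.mem_Ico]
  constructor
  · rintro ⟨a, h, rfl⟩
    exact h
  · intro h
    exact ⟨⟨t, by omega⟩, h, rfl⟩

theorem card_walkPos_eq {n i j : ℕ} (hij : i ≤ j) (hj : j ≤ n) :
    (Finset.univ.filter (fun w : Walk 2 n => walkPos w i = walkPos w j)).card =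
      (balancedCount (j - i) * 2 ^ (n - (j - i))) ^ 2 := by
  have h := card_boolSign_sum_finset_eq_zero
    (Finset.univ.filter (fun t : Fin n => i ≤ t ∧ (t : ℕ) < j))
  rw [card_fin_filter_Ico hj, Fintype.card_fin] at h
  rw [← h, sq, ← Finset.card_product]
  refine Finset.card_equiv ((Equiv.arrowCongr (Equiv.refl (Fin n)) stepEquiv).trans
    (Equiv.arrowProdEquivProdArrow (Fin n) (fun _ => Bool) (fun _ => Bool))) ?_
  intro w
  simp only [Finset.mem_filter, Finset.mem_univ, true_and, Finset.mem_product,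
    walkPos_eq_iff w hij]
  rfl

/-- The probability that the planar simple random walk is at the origin after `k` steps. -/
noncomputable def returnProb (k : ℕ) : ℝ := ((balancedCount k : ℝ) / 2 ^ k) ^ 2

theorem prob_walkPos_eq {n i j : ℕ} (hij : i ≤ j) (hj : j ≤ n) :
    ((Finset.univ.filter (fun w : Walk 2 n => walkPos w i = walkPos w j)).card : ℝ) / 4 ^ n =
      returnProb (j - i) := by
  rw [card_walkPos_eq hij hj, returnProb]
  obtain ⟨l, hl⟩ : ∃ l, n = (j - i) + l := ⟨n - (j - i), by omega⟩
  generalize j - i = k at *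
  subst hl
  have h4 : (4 : ℝ) ^ (k + l) = (2 ^ k * 2 ^ l) ^ 2 := by
    rw [← pow_add, ← pow_mul, mul_comm, pow_mul]
    norm_num
  rw [h4, Nat.add_sub_cancel_left]
  push_cast
  field_simp

theorem sum_sum_range_sub (f : ℕ → ℝ) (n : ℕ) :
    ∑ j ∈ Finset.range (n + 1), ∑ i ∈ Finset.range j, f (j - i) =
      ∑ k ∈ Finset.range n, ((n : ℝ) - k) * f (k + 1) := by
  have h : ∀ j, ∑ i ∈ Finset.range j, f (j - i) = ∑ k ∈ Finset.range j, f (k + 1) := by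
    intro j
    rw [← Finset.sum_range_reflect]
    refine Finset.sum_congr rfl fun i hi => ?_
    rw [Finset.mem_range] at hi
    congr 1
    omega
  simp_rw [h]
  induction n with
  | zero => simp
  | succ n ih =>
    rw [Finset.sum_range_succ, ih, Finset.sum_range_succ, Finset.sum_range_succ, ← add_assoc,
      ← Finset.sum_add_distrib]
    congr 1
    · refine Finset.sum_congr rfl fun k _ => ?_
      push_cast
      ring
    · push_cast
      ring

theorem E0_silt (n : ℕ) :
    E0 2 n (fun w => (silt w : ℝ)) =
      ∑ k ∈ Finset.range n, ((n : ℝ) - k) * returnProb (k + 1) := by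
  rw [← sum_sum_range_sub]
  have h : ∀ w : Walk 2 n, (silt w : ℝ) = ∑ j ∈ Finset.range (n + 1), ∑ i ∈ Finset.range j,
      if walkPos w i = walkPos w j then 1 else 0 := by
    intro w
    rw [silt, Finset.card_filter, Finset.sum_product_right]
    push_cast
    refine Finset.sum_congr rfl fun j hj => ?_
    rw [Finset.mem_range] at hj
    simp_rw [ite_and]
    rw [← Finset.sum_filter]
    refine Finset.sum_congr ?_ fun _ _ => rfl
    ext i
    simp only [Finset.mem_filter, Finset.mem_range]
    omega
  unfold E0
  simp_rw [h]
  rw [Finset.sum_comm, Finset.sum_div]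
  refine Finset.sum_congr rfl fun j hj => ?_
  rw [Finset.sum_comm, Finset.sum_div]
  refine Finset.sum_congr rfl fun i hi => ?_
  rw [Finset.mem_range] at hi hj
  rw [← prob_walkPos_eq (n := n) hi.le (by omega), Finset.sum_boole]
  norm_num

theorem returnProb_of_not_even {k : ℕ} (hk : ¬ Even k) : returnProb k = 0 := by
  simp [returnProb, balancedCount, hk]

theorem returnProb_two_mul (m : ℕ) :
    returnProb (2 * m) = 1 / (Real.Wallis.W m * (2 * m + 1)) := by
  have h := Nat.choose_mul_factorial_mul_factorial (show m ≤ 2 * m by omega)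
  have h' : (((2 * m).choose m : ℕ) : ℝ) * (m.factorial : ℝ) * (m.factorial : ℝ) =
      ((2 * m).factorial : ℝ) := by
    rw [show 2 * m - m = m by omega] at h
    exact_mod_cast h
  have hm : (m.factorial : ℝ) ≠ 0 := by positivity
  have hm2 : ((2 * m).choose m : ℝ) ≠ 0 := by
    exact_mod_cast (Nat.choose_pos (by omega)).ne'
  rw [returnProb, balancedCount, if_pos (even_two_mul m), Real.Wallis.W_eq_factorial_ratio,
    Nat.mul_div_cancel_left _ two_pos, ← h']
  field_simp
  ring

theorem returnProb_le (m : ℕ) :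
    returnProb (2 * (m + 1)) ≤ 1 / (Real.pi * (m + 1)) := by
  rw [returnProb_two_mul]
  have h := Real.Wallis.le_W (m + 1)
  have hpi := Real.pi_pos
  have h1 : Real.pi * (m + 1) ≤
      (2 * (m + 1 : ℝ) + 1) / (2 * (m + 1) + 2) * (Real.pi / 2) * (2 * (m + 1) + 1) := by
    rw [← sub_nonneg]
    have : (2 * (m + 1 : ℝ) + 1) / (2 * (m + 1) + 2) * (Real.pi / 2) * (2 * (m + 1) + 1) -
        Real.pi * (m + 1) = Real.pi / (2 * (2 * (m + 1) + 2)) := by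
      field_simp
      ring
    rw [this]
    positivity
  push_cast at h ⊢
  apply one_div_le_one_div_of_le (by positivity)
  refine h1.trans ?_
  gcongr

theorem le_returnProb (m : ℕ) :
    2 / (Real.pi * (2 * m + 1)) ≤ returnProb (2 * m) := by
  rw [returnProb_two_mul, show 2 / (Real.pi * (2 * m + 1)) =
    1 / (Real.pi / 2 * (2 * (m : ℝ) + 1)) by field_simp]
  have := Real.Wallis.W_pos m
  apply one_div_le_one_div_of_le (by positivity)
  gcongr
  exact Real.Wallis.W_le m

theorem E0_silt_eq_sum_even (n : ℕ) :
    E0 2 n (fun w => (silt w : ℝ)) =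
      ∑ m ∈ Finset.range (n / 2), ((n : ℝ) - (2 * m + 1)) * returnProb (2 * (m + 1)) := by
  rw [E0_silt]
  symm
  refine Finset.sum_of_injOn (fun m => 2 * m + 1) ?_ ?_ ?_ ?_
  · intro a _ b _ h
    simpa using h
  · intro m hm
    simp only [Finset.coe_range, Set.mem_Iio] at hm ⊢
    omega
  · intro k hk hk'
    rw [returnProb_of_not_even, mul_zero]
    rintro ⟨r, hr⟩
    apply hk'
    rw [Finset.mem_range] at hk
    exact ⟨r - 1, by simp only [Finset.coe_range, Set.mem_Iio]; omega, by simp only; omega⟩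
  · intro m _
    push_cast
    ring_nf

theorem E0_silt_le {n : ℕ} (hn : 1 ≤ n) :
    E0 2 n (fun w => (silt w : ℝ)) ≤ n / Real.pi * (1 + Real.log n) := by
  have hpi := Real.pi_pos
  rw [E0_silt_eq_sum_even]
  calc ∑ m ∈ Finset.range (n / 2), ((n : ℝ) - (2 * m + 1)) * returnProb (2 * (m + 1))
      ≤ ∑ m ∈ Finset.range (n / 2), (n : ℝ) * (1 / (Real.pi * (m + 1))) := by
        refine Finset.sum_le_sum fun m _ => ?_
        refine mul_le_mul (by linarith [(Nat.cast_nonneg m : (0 : ℝ) ≤ m)]) (returnProb_le m)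
          (sq_nonneg _) (Nat.cast_nonneg n)
    _ = n / Real.pi * (harmonic (n / 2) : ℝ) := by
        rw [harmonic, Rat.cast_sum, Finset.mul_sum]
        refine Finset.sum_congr rfl fun m _ => ?_
        push_cast
        field_simp
    _ ≤ n / Real.pi * (harmonic n : ℝ) := by
        gcongr
        unfold harmonic
        push_cast
        exact Finset.sum_le_sum_of_subset_of_nonneg
          (Finset.range_mono (Nat.div_le_self n 2)) fun _ _ _ => by positivity
    _ ≤ n / Real.pi * (1 + Real.log n) := by
        gcongr
        exact harmonic_le_one_add_log n

theorem le_E0_silt {n : ℕ} (hn : 1 ≤ n) :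
    n / Real.pi * (Real.log n - Real.log 2 - 2) ≤ E0 2 n (fun w => (silt w : ℝ)) := by
  have hpi := Real.pi_pos
  have hn' : (0 : ℝ) < n := by exact_mod_cast hn
  rw [E0_silt_eq_sum_even]
  have hharm : Real.log n - Real.log 2 - 1 ≤
      ∑ m ∈ Finset.range (n / 2), 1 / ((m : ℝ) + 2) := by
    have h := log_add_one_le_harmonic (n / 2 + 1)
    rw [harmonic, Finset.sum_range_succ'] at h
    push_cast at h
    rw [← Real.log_div hn'.ne' two_ne_zero]
    have h2 : Real.log (n / 2) ≤ Real.log (((n / 2 : ℕ) : ℝ) + 1 + 1) := by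
      apply Real.log_le_log (by positivity)
      have h3 : n ≤ 2 * (n / 2) + 2 := by omega
      have h4 : (n : ℝ) ≤ 2 * ((n / 2 : ℕ) : ℝ) + 2 := by exact_mod_cast h3
      linarith
    have h5 : ∑ m ∈ Finset.range (n / 2), 1 / ((m : ℝ) + 2) =
        ∑ m ∈ Finset.range (n / 2), ((m : ℝ) + 1 + 1)⁻¹ := by
      refine Finset.sum_congr rfl fun m _ => ?_
      rw [one_div]
      ring_nf
    norm_num at h
    rw [h5]
    linarith
  calc n / Real.pi * (Real.log n - Real.log 2 - 2)
      ≤ n / Real.pi * (∑ m ∈ Finset.range (n / 2), 1 / ((m : ℝ) + 2)) - n / Real.pi := by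
        rw [← mul_sub_one]
        exact mul_le_mul_of_nonneg_left (by linarith) (by positivity)
    _ ≤ n / Real.pi * (∑ m ∈ Finset.range (n / 2), 1 / ((m : ℝ) + 2)) -
          (n / 2 : ℕ) * (2 / Real.pi) := by
        have h3 : 2 * (n / 2) ≤ n := by omega
        have h4 : 2 * ((n / 2 : ℕ) : ℝ) ≤ n := by exact_mod_cast h3
        rw [mul_div_assoc', mul_comm _ (2 : ℝ)]
        gcongr
    _ = ∑ m ∈ Finset.range (n / 2), (n / Real.pi * (1 / ((m : ℝ) + 2)) - 2 / Real.pi) := by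
        rw [Finset.sum_sub_distrib, Finset.mul_sum]
        simp
    _ ≤ ∑ m ∈ Finset.range (n / 2), ((n : ℝ) - (2 * m + 1)) * returnProb (2 * (m + 1)) := by
        refine Finset.sum_le_sum fun m hm => ?_
        rw [Finset.mem_range] at hm
        have h3 : 2 * m + 1 ≤ n := by omega
        have h4 : 2 * (m : ℝ) + 1 ≤ n := by exact_mod_cast h3
        have h5 := mul_le_mul_of_nonneg_left (le_returnProb (m + 1)) (sub_nonneg.2 h4)
        refine le_trans ?_ h5
        rw [← sub_nonneg]
        push_cast
        have : ((n : ℝ) - (2 * m + 1)) * (2 / (Real.pi * (2 * (m + 1) + 1))) -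
            (n / Real.pi * (1 / ((m : ℝ) + 2)) - 2 / Real.pi) =
            (n * (1 / ((2 * m + 3) * (m + 2))) + 4 / (2 * m + 3)) / Real.pi := by
          field_simp
          ring
        rw [this]
        positivity

/-- for the simple random walk in `ℤ²`,
`E₀(J_n) = (1/π + o(1)) n ln n`, i.e. `E₀(J_n)/(n ln n) → 1/π`. -/
theorem srw_silt_two_dim :
    Filter.Tendsto
      (fun n : ℕ => E0 2 n (fun w => (silt w : ℝ)) / ((n : ℝ) * Real.log n))
      Filter.atTop (nhds (1 / Real.pi)) := by
  have hpi := Real.pi_pos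
  have hlog : Tendsto (fun n : ℕ => Real.log n) atTop atTop :=
    Real.tendsto_log_atTop.comp tendsto_natCast_atTop_atTop
  have hlim : ∀ c : ℝ, Tendsto (fun n : ℕ => 1 / Real.pi * (1 + c / Real.log n)) atTop
      (nhds (1 / Real.pi)) := by
    intro c
    simpa using ((hlog.const_div_atTop c).const_add 1).const_mul (1 / Real.pi)
  refine tendsto_of_tendsto_of_tendsto_of_le_of_le' (hlim (-Real.log 2 - 2)) (hlim 1) ?_ ?_
  · filter_upwards [eventually_ge_atTop 2] with n hn
    have hn' : (0 : ℝ) < n := by positivity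
    have hl : 0 < Real.log n := Real.log_pos (by exact_mod_cast hn)
    rw [le_div_iff₀ (by positivity)]
    refine le_trans (le_of_eq ?_) (le_E0_silt (by omega))
    field_simp
    ring
  · filter_upwards [eventually_ge_atTop 2] with n hn
    have hn' : (0 : ℝ) < n := by positivity
    have hl : 0 < Real.log n := Real.log_pos (by exact_mod_cast hn)
    rw [div_le_iff₀ (by positivity)]
    refine (E0_silt_le (by omega)).trans (le_of_eq ?_)
    field_simp
    ring
end

section
/- Let β > 0 and d = 1. Then there exists a constant m₂(β) > 0 (which may depend on β) such that the mean square displacement of the one-dimensional weakly self-avoiding walk satisfies m₂(β) ≤ liminf_{n→∞} E_β(χ_n²)/n² and limsup_{n→∞} E_β(χ_n²)/n² ≤ 1; this follows from the linear growth of E_β(χ_n) together with E_β(χ_n²) ≥ (E_β(χ_n))² and the trivial bound χ_n ≤ n. -/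
open Filter

/-- The position of a one-dimensional walk, as an integer. -/
def linePos {n : ℕ} (w : Walk 1 n) (i : ℕ) : ℤ := walkPos w i 0

lemma walkPos_eq_iff_s19 {n : ℕ} (w : Walk 1 n) (i j : ℕ) :
    walkPos w i = walkPos w j ↔ linePos w i = linePos w j := by
  constructor
  · intro h
    exact congrFun h 0
  · intro h
    funext k
    rw [Subsingleton.elim k 0]
    exact h

lemma stepVec_one (s : Fin 1 × Bool) : stepVec 1 s 0 = if s.2 then 1 else -1 := by
  simp [stepVec, Subsingleton.elim s.1 0]

lemma linePos_zero {n : ℕ} (w : Walk 1 n) : linePos w 0 = 0 := by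
  simp [linePos, walkPos]

lemma linePos_succ {n : ℕ} (w : Walk 1 n) {i : ℕ} (hi : i < n) :
    linePos w (i + 1) = linePos w i + if (w ⟨i, hi⟩).2 then 1 else -1 := by
  have h : Finset.filter (fun j : Fin n => (j : ℕ) < i + 1) Finset.univ
      = insert ⟨i, hi⟩ (Finset.filter (fun j : Fin n => (j : ℕ) < i) Finset.univ) := by
    ext j
    simp only [Finset.mem_filter, Finset.mem_univ, true_and, Finset.mem_insert, Fin.ext_iff]
    omega
  unfold linePos walkPos
  rw [h, Finset.sum_insert (by simp), stepVec_one, add_comm]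

lemma abs_linePos_succ_sub {n : ℕ} (w : Walk 1 n) {i : ℕ} (hi : i < n) :
    |linePos w (i + 1) - linePos w i| ≤ 1 := by
  rw [linePos_succ w hi]
  split_ifs <;> simp

lemma abs_linePos_le {n : ℕ} (w : Walk 1 n) {i : ℕ} (hi : i ≤ n) : |linePos w i| ≤ i := by
  induction i with
  | zero => simp [linePos_zero]
  | succ i ih =>
    have h1 := ih (by omega)
    have h2 := abs_linePos_succ_sub w (show i < n by omega)
    rw [abs_le] at *
    push_cast
    omega

lemma chi_sq {n : ℕ} (w : Walk 1 n) : chi w ^ 2 = (linePos w n : ℝ) ^ 2 := by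
  unfold chi
  rw [Real.sq_sqrt (by positivity)]
  simp [linePos]

/-- The pairs of times counted by the self-intersection local time. -/
def selfPairs {n : ℕ} (w : Walk 1 n) : Finset (ℕ × ℕ) :=
  ((Finset.range (n + 1)) ×ˢ (Finset.range (n + 1))).filter
    (fun p => p.1 < p.2 ∧ linePos w p.1 = linePos w p.2)

lemma silt_eq_card_selfPairs {n : ℕ} (w : Walk 1 n) : silt w = (selfPairs w).card := by
  unfold silt selfPairs
  simp only [walkPos_eq_iff_s19]

lemma mem_selfPairs {n : ℕ} (w : Walk 1 n) (p : ℕ × ℕ) :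
    p ∈ selfPairs w ↔ p.1 < p.2 ∧ p.2 ≤ n ∧ linePos w p.1 = linePos w p.2 := by
  simp only [selfPairs, Finset.mem_filter, Finset.mem_product, Finset.mem_range]
  constructor
  · rintro ⟨h, h1, h2⟩
    exact ⟨h1, by omega, h2⟩
  · rintro ⟨h, h1, h2⟩
    exact ⟨by omega, h, h2⟩

/-- Reverse every step of the walk from time `T` on. -/
def flipAfter {n : ℕ} (T : ℕ) (w : Walk 1 n) : Walk 1 n :=
  fun j => if (j : ℕ) < T then w j else ((w j).1, !(w j).2)

lemma flipAfter_involutive {n : ℕ} (T : ℕ) :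
    Function.Involutive (flipAfter T : Walk 1 n → Walk 1 n) := by
  intro w
  funext j
  unfold flipAfter
  split_ifs <;> simp

lemma linePos_flipAfter_of_le {n : ℕ} (T : ℕ) (w : Walk 1 n) {i : ℕ} (hi : i ≤ T) (hn : i ≤ n) :
    linePos (flipAfter T w) i = linePos w i := by
  induction i with
  | zero => simp [linePos_zero]
  | succ i ih =>
    rw [linePos_succ _ (show i < n by omega), linePos_succ _ (show i < n by omega),
      ih (by omega) (by omega)]
    simp [flipAfter, show i < T by omega]

lemma linePos_flipAfter_of_ge {n : ℕ} (T : ℕ) (w : Walk 1 n) {i : ℕ} (hi : T ≤ i) (hn : i ≤ n) :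
    linePos (flipAfter T w) i = 2 * linePos w T - linePos w i := by
  induction i, hi using Nat.le_induction with
  | base => rw [linePos_flipAfter_of_le T w le_rfl hn]; ring
  | succ i hi ih =>
    rw [linePos_succ _ (show i < n by omega), linePos_succ _ (show i < n by omega),
      ih (by omega)]
    simp only [flipAfter, show ¬ i < T by omega, if_false]
    cases (w ⟨i, by omega⟩).2 <;> simp <;> ring

lemma exists_eq_of_step_le_one (f : ℕ → ℤ) {a b : ℕ} (hab : a ≤ b)
    (hf : ∀ i, a ≤ i → i < b → |f (i + 1) - f i| ≤ 1) {v : ℤ} (ha : f a ≤ v) (hb : v ≤ f b) :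
    ∃ i, a ≤ i ∧ i ≤ b ∧ f i = v := by
  induction b, hab using Nat.le_induction with
  | base => exact ⟨a, le_rfl, le_rfl, le_antisymm ha hb⟩
  | succ b hab ih =>
    by_cases h : v ≤ f b
    · obtain ⟨i, h1, h2, h3⟩ := ih (fun i h1 h2 => hf i h1 (by omega)) h
      exact ⟨i, h1, by omega, h3⟩
    · refine ⟨b + 1, by omega, le_rfl, ?_⟩
      have := abs_le.mp (hf b hab (by omega))
      omega

lemma exists_first_max_abs {n : ℕ} (w : Walk 1 n) :
    ∃ T ≤ n, (∀ i ≤ n, |linePos w i| ≤ |linePos w T|) ∧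
      ∀ i < T, |linePos w i| < |linePos w T| := by
  classical
  have hex : ∃ T, T ≤ n ∧ ∀ i ≤ n, |linePos w i| ≤ |linePos w T| := by
    obtain ⟨T, hT, h⟩ := Finset.exists_max_image (Finset.range (n + 1))
      (fun i => |linePos w i|) ⟨0, by simp⟩
    simp only [Finset.mem_range, Nat.lt_succ_iff] at hT h
    exact ⟨T, hT, h⟩
  obtain ⟨h1, h2⟩ := Nat.find_spec hex
  refine ⟨Nat.find hex, h1, h2, fun i hi => ?_⟩
  by_contra! hle
  exact Nat.find_min hex hi ⟨by omega, fun j hj => (h2 j hj).trans hle⟩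

/-- Reflecting the walk at the first time its distance from the origin is maximal removes at
least one self-intersection for each level on the way back. -/
lemma silt_flipAfter_add_le {n T : ℕ} (w : Walk 1 n) (hT : T ≤ n)
    (hmax : ∀ i ≤ n, |linePos w i| ≤ |linePos w T|)
    (hfirst : ∀ i < T, |linePos w i| < |linePos w T|) :
    (silt (flipAfter T w) : ℤ) + (|linePos w T| - |linePos w n|) ≤ silt w := by
  classical
  obtain ⟨σ, hσ, hσT⟩ : ∃ σ : ℤ, (σ = 1 ∨ σ = -1) ∧ σ * linePos w T = |linePos w T| := by
    rcases le_total 0 (linePos w T) with h | h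
    · exact ⟨1, Or.inl rfl, by rw [abs_of_nonneg h]; ring⟩
    · exact ⟨-1, Or.inr rfl, by rw [abs_of_nonpos h]; ring⟩
  have hσabs : ∀ x : ℤ, σ * x ≤ |x| := by
    intro x
    rcases hσ with rfl | rfl
    · simpa using le_abs_self x
    · simpa using neg_le_abs x
  have hσinj : ∀ x y : ℤ, σ * x = σ * y → x = y := by
    intro x y h
    rcases hσ with rfl | rfl <;> omega
  have hstep : ∀ i, i < n → |σ * linePos w (i + 1) - σ * linePos w i| ≤ 1 := by
    intro i hi
    have := abs_linePos_succ_sub w hi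
    rw [abs_le] at *
    rcases hσ with rfl | rfl <;> omega
  set K := |linePos w T| with hK
  have hlevel : ∀ v ∈ Finset.Ico |linePos w n| K,
      ∃ p : ℕ × ℕ, p.1 < T ∧ T < p.2 ∧ p.2 ≤ n ∧ σ * linePos w p.1 = v ∧
        σ * linePos w p.2 = v := by
    intro v hv
    rw [Finset.mem_Ico] at hv
    have hv0 := abs_nonneg (linePos w n)
    obtain ⟨i, -, hi, hiv⟩ := exists_eq_of_step_le_one (fun i => σ * linePos w i)
      (Nat.zero_le T) (fun i _ h => hstep i (by omega)) (v := v)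
      (by simp only [linePos_zero]; omega) (by omega)
    obtain ⟨j, hj, hjn, hjv⟩ := exists_eq_of_step_le_one (fun i => -(σ * linePos w i))
      hT (fun i _ h => by
        have := hstep i h
        rw [abs_le] at *
        constructor <;> linarith [this.1, this.2]) (v := -v)
      (by omega) (by have := hσabs (linePos w n); omega)
    refine ⟨(i, j), ?_, ?_, hjn, hiv, neg_injective hjv⟩
    · rcases hi.lt_or_eq with h | h
      · exact h
      · subst h; omega
    · rcases hj.lt_or_eq with h | h
      · exact h
      · subst h; omega
  choose! p hp1 hp2 hp3 hp4 hp5 using hlevel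
  have hsub : selfPairs (flipAfter T w) ∪ (Finset.Ico |linePos w n| K).image p
      ⊆ selfPairs w := by
    intro q hq
    rw [Finset.mem_union, Finset.mem_image] at hq
    rcases hq with hq | ⟨v, hv, rfl⟩
    · rw [mem_selfPairs] at hq ⊢
      obtain ⟨h1, h2, h3⟩ := hq
      refine ⟨h1, h2, ?_⟩
      rcases le_total q.2 T with h | h
      · rwa [linePos_flipAfter_of_le T w (by omega) (by omega),
          linePos_flipAfter_of_le T w h h2] at h3
      · rcases le_or_gt T q.1 with h' | h'
        · rw [linePos_flipAfter_of_ge T w h' (by omega),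
            linePos_flipAfter_of_ge T w h h2] at h3
          omega
        · exfalso
          rw [linePos_flipAfter_of_le T w h'.le (by omega),
            linePos_flipAfter_of_ge T w h h2] at h3
          have h4 := hfirst _ h'
          have h5 := hmax _ h2
          rw [h3, hK] at h4
          rw [hK] at h5
          grind
    · rw [mem_selfPairs]
      have a1 := hp1 v hv
      have a2 := hp2 v hv
      exact ⟨by omega, hp3 v hv, hσinj _ _ ((hp4 v hv).trans (hp5 v hv).symm)⟩
  have hdisj : Disjoint (selfPairs (flipAfter T w))
      ((Finset.Ico |linePos w n| K).image p) := by
    rw [Finset.disjoint_right]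
    intro q hq hq'
    rw [Finset.mem_image] at hq
    obtain ⟨v, hv, rfl⟩ := hq
    rw [mem_selfPairs] at hq'
    have h3 := hq'.2.2
    rw [linePos_flipAfter_of_le T w (hp1 v hv).le (by have := hp1 v hv; omega),
      linePos_flipAfter_of_ge T w (hp2 v hv).le (hp3 v hv)] at h3
    have h4 := hfirst _ (hp1 v hv)
    have h5 := hmax _ (hp3 v hv)
    rw [h3, hK] at h4
    rw [hK] at h5
    grind
  have hinj : Set.InjOn p (Finset.Ico |linePos w n| K : Finset ℤ) := by
    intro u hu v hv huv
    rw [← hp4 u hu, ← hp4 v hv, huv]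
  have hcard := Finset.card_le_card hsub
  rw [Finset.card_union_of_disjoint hdisj, Finset.card_image_of_injOn hinj, Int.card_Ico,
    ← silt_eq_card_selfPairs, ← silt_eq_card_selfPairs] at hcard
  have := Int.self_le_toNat (K - |linePos w n|)
  omega

/-- A walk confined to `[-K, K]` has many self-intersections. -/
lemma sq_le_mul_silt {n : ℕ} (w : Walk 1 n) (K : ℕ) (hK : ∀ i ≤ n, |linePos w i| ≤ K) :
    (n + 1) ^ 2 ≤ (2 * K + 1) * (n + 1 + 2 * silt w) := by
  classical
  set R := Finset.range (n + 1) with hR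
  set I := Finset.Icc (-(K : ℤ)) K with hI
  have hmaps : ∀ i ∈ R, linePos w i ∈ I := by
    intro i hi
    rw [hI, Finset.mem_Icc, ← abs_le]
    exact hK i (by simpa [hR, Nat.lt_succ_iff] using hi)
  have hIcard : I.card = 2 * K + 1 := by
    rw [hI, Int.card_Icc]
    omega
  have hsum := Finset.card_eq_sum_card_fiberwise hmaps
  have hRcard : R.card = n + 1 := by simp [hR]
  have hcs := sq_sum_le_card_mul_sum_sq (s := I)
    (f := fun v => (R.filter (fun i => linePos w i = v)).card)
  rw [← hsum, hRcard, hIcard] at hcs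
  refine hcs.trans (Nat.mul_le_mul_left _ (le_of_eq ?_))
  set A := (R ×ˢ R).filter (fun p : ℕ × ℕ => linePos w p.1 = linePos w p.2) with hA
  have hAcard : A.card = ∑ v ∈ I, (R.filter (fun i => linePos w i = v)).card ^ 2 := by
    have hm : ∀ p ∈ A, linePos w p.1 ∈ I := by
      intro p hp
      simp only [hA, Finset.mem_filter, Finset.mem_product] at hp
      exact hmaps _ hp.1.1
    rw [Finset.card_eq_sum_card_fiberwise hm]
    refine Finset.sum_congr rfl fun v _ => ?_
    rw [sq, ← Finset.card_product]
    congr 1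
    ext q
    simp only [hA, Finset.mem_filter, Finset.mem_product]
    grind
  rw [← hAcard]
  have hsplit : A = (R.image fun i => (i, i)) ∪
      (selfPairs w ∪ (selfPairs w).image Prod.swap) := by
    ext ⟨i, j⟩
    simp only [hA, hR, Finset.mem_filter, Finset.mem_product, Finset.mem_range, Finset.mem_union,
      Finset.mem_image, mem_selfPairs, Prod.mk.injEq, Prod.exists, Prod.swap_prod_mk]
    constructor
    · rintro ⟨⟨h1, h2⟩, h3⟩
      rcases lt_trichotomy i j with h | h | h
      · exact Or.inr (Or.inl ⟨h, by omega, h3⟩)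
      · exact Or.inl ⟨i, h1, rfl, h⟩
      · exact Or.inr (Or.inr ⟨j, i, ⟨h, by omega, h3.symm⟩, rfl, rfl⟩)
    · rintro (⟨a, h, rfl, rfl⟩ | ⟨h1, h2, h3⟩ | ⟨a, b, ⟨h1, h2, h3⟩, rfl, rfl⟩)
      · exact ⟨⟨h, h⟩, rfl⟩
      · exact ⟨by omega, h3⟩
      · exact ⟨by omega, h3.symm⟩
  have hd1 : Disjoint (selfPairs w) ((selfPairs w).image Prod.swap) := by
    rw [Finset.disjoint_right]
    rintro q hq hq'
    obtain ⟨r, hr, rfl⟩ := Finset.mem_image.mp hq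
    rw [mem_selfPairs] at hr hq'
    have := hr.1
    have := hq'.1
    simp only [Prod.fst_swap, Prod.snd_swap] at this
    omega
  have hd2 : Disjoint (R.image fun i => (i, i))
      (selfPairs w ∪ (selfPairs w).image Prod.swap) := by
    rw [Finset.disjoint_left]
    rintro q hq hq'
    obtain ⟨i, -, rfl⟩ := Finset.mem_image.mp hq
    rcases Finset.mem_union.mp hq' with h | h
    · rw [mem_selfPairs] at h
      exact lt_irrefl _ h.1
    · obtain ⟨r, hr, hre⟩ := Finset.mem_image.mp h
      rw [mem_selfPairs] at hr
      have h1 := congrArg Prod.fst hre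
      have h2 := congrArg Prod.snd hre
      simp only [Prod.fst_swap, Prod.snd_swap] at h1 h2
      omega
  rw [hsplit, Finset.card_union_of_disjoint hd2, Finset.card_union_of_disjoint hd1,
    Finset.card_image_of_injective _ Prod.swap_injective,
    Finset.card_image_of_injective _ (fun i j h => congrArg Prod.fst h), hRcard,
    ← silt_eq_card_selfPairs]
  ring

/-- The unnormalised weight of a walk. -/
noncomputable def siltWeight {n : ℕ} (β : ℝ) (w : Walk 1 n) : ℝ :=
  Real.exp (-β * (silt w : ℝ))

lemma siltWeight_pos {n : ℕ} (β : ℝ) (w : Walk 1 n) : 0 < siltWeight β w := Real.exp_pos _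

lemma one_le_sum_siltWeight (n : ℕ) (β : ℝ) : 1 ≤ ∑ w : Walk 1 n, siltWeight β w := by
  let w₀ : Walk 1 n := fun _ => (0, true)
  have hpos : ∀ i ≤ n, linePos w₀ i = i := by
    intro i hi
    induction i with
    | zero => simp [linePos_zero]
    | succ i ih =>
      rw [linePos_succ w₀ (show i < n by omega), ih (by omega)]
      simp [w₀]
  have h0 : silt w₀ = 0 := by
    rw [silt_eq_card_selfPairs, Finset.card_eq_zero, Finset.eq_empty_iff_forall_notMem]
    intro p hp
    rw [mem_selfPairs] at hp
    obtain ⟨h1, h2, h3⟩ := hp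
    rw [hpos _ (by omega), hpos _ h2] at h3
    omega
  calc (1 : ℝ) = siltWeight β w₀ := by simp [siltWeight, h0]
    _ ≤ _ := Finset.single_le_sum (f := siltWeight β) (fun w _ => (siltWeight_pos β w).le)
      (Finset.mem_univ w₀)

lemma sum_siltWeight_flipAfter (n T : ℕ) (β : ℝ) :
    ∑ w : Walk 1 n, siltWeight β (flipAfter T w) = ∑ w : Walk 1 n, siltWeight β w :=
  Equiv.sum_comp (flipAfter_involutive T).toPerm (siltWeight β)

lemma siltWeight_le_of_abs_linePos_lt {n : ℕ} {β c : ℝ} (hβ : 0 < β)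
    (hc : c = β / (8 * (β + 2))) (hn : 1 ≤ 4 * c * n) (w : Walk 1 n)
    (hw : |(linePos w n : ℝ)| < c * n) :
    siltWeight β w ≤ Real.exp (-n) +
      ∑ T ∈ Finset.range (n + 1), Real.exp (-β * (c * n)) * siltWeight β (flipAfter T w) := by
  obtain ⟨T, hT, hmax, hfirst⟩ := exists_first_max_abs w
  have hc0 : 0 < c := by rw [hc]; positivity
  have hsum0 : ∀ T ∈ Finset.range (n + 1),
      0 ≤ Real.exp (-β * (c * n)) * siltWeight β (flipAfter T w) := fun T _ =>
    mul_nonneg (Real.exp_pos _).le (siltWeight_pos β _).le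
  by_cases hK : (|linePos w T| : ℝ) < 2 * c * n
  · have h1 := sq_le_mul_silt w (linePos w T).natAbs (by simpa using hmax)
    have h2 : ((n : ℝ) + 1) ^ 2 ≤
        (2 * |(linePos w T : ℝ)| + 1) * (n + 1 + 2 * (silt w : ℝ)) := by
      have h3 : (((n + 1) ^ 2 : ℕ) : ℝ) ≤
        (((2 * (linePos w T).natAbs + 1) * (n + 1 + 2 * silt w) : ℕ) : ℝ) := by
        exact_mod_cast h1
      push_cast [Nat.cast_natAbs] at h3
      exact h3
    have h4 : ((n : ℝ) + 1) ^ 2 ≤ (8 * c * n) * (n + 1 + 2 * (silt w : ℝ)) :=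
      h2.trans (mul_le_mul_of_nonneg_right (by linarith) (by positivity))
    have h5 : (n : ℝ) ≤ β * silt w := by
      have hc8 : 8 * c * (β + 2) = β := by rw [hc]; field_simp
      have hn0 : (0 : ℝ) < n := by
        by_contra! h
        nlinarith
      have h6 : (n : ℝ) + 1 ≤ (8 * c) * (n + 1 + 2 * (silt w : ℝ)) := by
        have h7 : (n : ℝ) * (n + 1) ≤ n * ((8 * c) * (n + 1 + 2 * (silt w : ℝ))) := by
          nlinarith
        exact le_of_mul_le_mul_left h7 hn0
      have h8 : ((n : ℝ) + 1) * (β + 2) ≤ β * (n + 1 + 2 * (silt w : ℝ)) := by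
        calc ((n : ℝ) + 1) * (β + 2)
            ≤ ((8 * c) * (n + 1 + 2 * (silt w : ℝ))) * (β + 2) :=
              mul_le_mul_of_nonneg_right h6 (by linarith)
          _ = (8 * c * (β + 2)) * (n + 1 + 2 * (silt w : ℝ)) := by ring
          _ = _ := by rw [hc8]
      nlinarith
    have h9 : siltWeight β w ≤ Real.exp (-n) := Real.exp_le_exp.mpr (by linarith)
    linarith [Finset.sum_nonneg hsum0]
  · push Not at hK
    have h1 := silt_flipAfter_add_le w hT hmax hfirst
    have h2 : (silt (flipAfter T w) : ℝ) + (|(linePos w T : ℝ)| - |(linePos w n : ℝ)|)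
        ≤ silt w := by exact_mod_cast h1
    have h3 : siltWeight β w ≤ Real.exp (-β * (c * n)) * siltWeight β (flipAfter T w) := by
      unfold siltWeight
      rw [← Real.exp_add, Real.exp_le_exp]
      have : c * n + silt (flipAfter T w) ≤ (silt w : ℝ) := by linarith
      nlinarith
    have h4 := Finset.single_le_sum hsum0 (Finset.mem_range.mpr (Nat.lt_succ_of_le hT))
    linarith [Real.exp_pos (-(n : ℝ))]

lemma sum_siltWeight_abs_linePos_lt_le {n : ℕ} {β c : ℝ} (hβ : 0 < β)
    (hc : c = β / (8 * (β + 2))) (hn : 1 ≤ 4 * c * n) :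
    ∑ w : Walk 1 n with |(linePos w n : ℝ)| < c * n, siltWeight β w ≤
      (2 ^ n * Real.exp (-n) + (n + 1) * Real.exp (-β * (c * n))) *
        ∑ w : Walk 1 n, siltWeight β w := by
  have h1 : ∑ w : Walk 1 n with |(linePos w n : ℝ)| < c * n, siltWeight β w ≤
      ∑ w : Walk 1 n, (Real.exp (-n) +
        ∑ T ∈ Finset.range (n + 1), Real.exp (-β * (c * n)) * siltWeight β (flipAfter T w)) := by
    refine (Finset.sum_le_sum fun w hw => siltWeight_le_of_abs_linePos_lt hβ hc hn w
      (Finset.mem_filter.mp hw).2).trans ?_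
    refine Finset.sum_le_sum_of_subset_of_nonneg (Finset.filter_subset _ _) fun w _ _ => ?_
    exact add_nonneg (Real.exp_pos _).le (Finset.sum_nonneg fun T _ =>
      mul_nonneg (Real.exp_pos _).le (siltWeight_pos β _).le)
  refine h1.trans ?_
  rw [Finset.sum_add_distrib, Finset.sum_comm]
  simp only [← Finset.mul_sum, sum_siltWeight_flipAfter]
  have h2 := one_le_sum_siltWeight n β
  have h3 : (0 : ℝ) ≤ 2 ^ n * Real.exp (-n) := by positivity
  simp only [Finset.sum_const, Finset.card_univ, Finset.card_range, nsmul_eq_mul,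
    Fintype.card_fun, Fintype.card_prod, Fintype.card_fin, Fintype.card_bool]
  push_cast
  nlinarith

lemma tendsto_weight_bound {a : ℝ} (ha : 0 < a) :
    Tendsto (fun n : ℕ => 2 ^ n * Real.exp (-(n : ℝ)) + ((n : ℝ) + 1) * Real.exp (-a * n))
      atTop (nhds 0) := by
  have h1 : Tendsto (fun n : ℕ => (2 * Real.exp (-1)) ^ n) atTop (nhds 0) := by
    apply tendsto_pow_atTop_nhds_zero_of_lt_one (by positivity)
    rw [Real.exp_neg, ← div_eq_mul_inv, div_lt_one (Real.exp_pos 1)]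
    linarith [Real.exp_one_gt_d9]
  have hr : Real.exp (-a) < 1 := by rw [Real.exp_lt_one_iff]; linarith
  have h2 : Tendsto (fun n : ℕ => (n : ℝ) * Real.exp (-a) ^ n) atTop (nhds 0) :=
    tendsto_self_mul_const_pow_of_lt_one (Real.exp_pos _).le hr
  have h3 : Tendsto (fun n : ℕ => Real.exp (-a) ^ n) atTop (nhds 0) :=
    tendsto_pow_atTop_nhds_zero_of_lt_one (Real.exp_pos _).le hr
  have h4 := h1.add (h2.add h3)
  simp only [add_zero] at h4
  refine h4.congr fun n => ?_
  rw [mul_pow, ← Real.exp_nat_mul, ← Real.exp_nat_mul]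
  ring_nf

lemma Ewsaw_chi_sq_eq (n : ℕ) (β : ℝ) :
    Ewsaw 1 n β (fun w => (chi w) ^ 2) =
      (∑ w : Walk 1 n, siltWeight β w * (linePos w n : ℝ) ^ 2) /
        ∑ w : Walk 1 n, siltWeight β w := by
  simp only [Ewsaw, chi_sq, siltWeight]

lemma Ewsaw_chi_sq_div_nonneg (n : ℕ) (β : ℝ) :
    0 ≤ Ewsaw 1 n β (fun w => (chi w) ^ 2) / (n : ℝ) ^ 2 := by
  rw [Ewsaw_chi_sq_eq]
  have h := one_le_sum_siltWeight n β
  refine div_nonneg (div_nonneg (Finset.sum_nonneg fun w _ => ?_) (by linarith)) (by positivity)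
  exact mul_nonneg (siltWeight_pos β w).le (sq_nonneg _)

lemma Ewsaw_chi_sq_div_le_one (n : ℕ) (β : ℝ) :
    Ewsaw 1 n β (fun w => (chi w) ^ 2) / (n : ℝ) ^ 2 ≤ 1 := by
  rw [Ewsaw_chi_sq_eq]
  have h := one_le_sum_siltWeight n β
  refine div_le_one_of_le₀ ?_ (by positivity)
  rw [div_le_iff₀ (by linarith), Finset.mul_sum]
  refine Finset.sum_le_sum fun w _ => ?_
  rw [mul_comm]
  refine mul_le_mul_of_nonneg_right ?_ (siltWeight_pos β w).le
  rw [sq_le_sq, abs_of_nonneg (Nat.cast_nonneg (α := ℝ) n)]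
  exact_mod_cast abs_linePos_le w le_rfl

lemma le_Ewsaw_chi_sq_div {n : ℕ} {β c : ℝ} (hc : 0 < c) (hn : 0 < n)
    (h : ∑ w : Walk 1 n with |(linePos w n : ℝ)| < c * n, siltWeight β w ≤
      1 / 2 * ∑ w : Walk 1 n, siltWeight β w) :
    c ^ 2 / 2 ≤ Ewsaw 1 n β (fun w => (chi w) ^ 2) / (n : ℝ) ^ 2 := by
  rw [Ewsaw_chi_sq_eq]
  have hW := one_le_sum_siltWeight n β
  have hn' : (0 : ℝ) < n := by exact_mod_cast hn
  rw [le_div_iff₀ (by positivity), le_div_iff₀ (by linarith)]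
  have hsplit := Finset.sum_filter_add_sum_filter_not (Finset.univ : Finset (Walk 1 n))
    (fun w => |(linePos w n : ℝ)| < c * n) (siltWeight β)
  have hle : ∑ w : Walk 1 n with ¬ |(linePos w n : ℝ)| < c * n, siltWeight β w * (c * n) ^ 2 ≤
      ∑ w : Walk 1 n, siltWeight β w * (linePos w n : ℝ) ^ 2 := by
    refine (Finset.sum_le_sum fun w hw => ?_).trans
      (Finset.sum_le_sum_of_subset_of_nonneg (Finset.filter_subset _ _) fun w _ _ =>
        mul_nonneg (siltWeight_pos β w).le (sq_nonneg _))
    have hw' := not_lt.mp (Finset.mem_filter.mp hw).2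
    refine mul_le_mul_of_nonneg_left ?_ (siltWeight_pos β w).le
    rw [sq_le_sq, abs_of_nonneg (by positivity : 0 ≤ c * (n : ℝ))]
    exact hw'
  rw [← Finset.sum_mul] at hle
  refine le_trans ?_ hle
  have : 1 / 2 * ∑ w : Walk 1 n, siltWeight β w ≤
      ∑ w : Walk 1 n with ¬ |(linePos w n : ℝ)| < c * n, siltWeight β w := by linarith
  calc c ^ 2 / 2 * (n : ℝ) ^ 2 * ∑ w : Walk 1 n, siltWeight β w
      = (1 / 2 * ∑ w : Walk 1 n, siltWeight β w) * (c * n) ^ 2 := by ring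
    _ ≤ _ := mul_le_mul_of_nonneg_right this (by positivity)

/-- the mean square displacement of the one-dimensional weakly
self-avoiding walk grows like `n²`: there is `m₂(β) > 0` with
`m₂(β) ≤ liminf E_β(χ_n²)/n²` and `limsup E_β(χ_n²)/n² ≤ 1`. -/
theorem wsaw_one_dim_msd (β : ℝ) (hβ : 0 < β) :
    ∃ m₂ : ℝ, 0 < m₂ ∧
      m₂ ≤ Filter.liminf
          (fun n : ℕ => Ewsaw 1 n β (fun w => (chi w)^2) / (n : ℝ)^2)
          Filter.atTop ∧
      Filter.limsup
          (fun n : ℕ => Ewsaw 1 n β (fun w => (chi w)^2) / (n : ℝ)^2)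
          Filter.atTop ≤ 1 := by
  set c : ℝ := β / (8 * (β + 2)) with hc
  have hc0 : 0 < c := by rw [hc]; positivity
  refine ⟨c ^ 2 / 2, by positivity, ?_, ?_⟩
  · refine le_liminf_of_le (isCoboundedUnder_ge_of_le atTop (x := 1)
      fun n => Ewsaw_chi_sq_div_le_one n β) ?_
    have h1 : ∀ᶠ n : ℕ in atTop, 2 ^ n * Real.exp (-(n : ℝ)) +
        ((n : ℝ) + 1) * Real.exp (-(β * c) * n) < 1 / 2 :=
      (tendsto_weight_bound (mul_pos hβ hc0)).eventually_lt_const (by norm_num)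
    have h2 : ∀ᶠ n : ℕ in atTop, 1 / (4 * c) ≤ (n : ℝ) :=
      tendsto_natCast_atTop_atTop.eventually_ge_atTop _
    filter_upwards [h1, h2, eventually_gt_atTop 0] with n h1 h2 hn
    rw [div_le_iff₀ (by positivity)] at h2
    refine le_Ewsaw_chi_sq_div hc0 hn
      ((sum_siltWeight_abs_linePos_lt_le hβ hc (by linarith)).trans ?_)
    refine mul_le_mul_of_nonneg_right ?_ (by linarith [one_le_sum_siltWeight n β])
    rw [show -β * (c * (n : ℝ)) = -(β * c) * n by ring]
    exact h1.le
  · exact limsup_le_of_le (isCoboundedUnder_le_of_le atTop (x := 0)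
      fun n => Ewsaw_chi_sq_div_nonneg n β)
      (Eventually.of_forall fun n => Ewsaw_chi_sq_div_le_one n β)
end
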